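/- Suppose k and m are cardinals with ℵ₀ ≤ k ≤ m, and A is an m-generated C*-algebra that is R_{<k}D. Then the family of Lemma 2(1) can be chosen so as to also realize every dimension below k: there exist an index set Λ with card Λ = m, nonzero complex Hilbert spaces (X_λ)_{λ∈Λ} with dim X_λ < k, and unital *-homomorphisms π_λ : A⁺ → B(X_λ) separating the points of A⁺, such that for every λ₀ ∈ Λ the set { λ : π_λ unitarily equivalent to π_{λ₀} } has cardinality m, and in addition for every nonzero cardinal s < k there exists λ ∈ Λ with dim X_λ = s. -/

import Mathlib

/- STATEMENT 4: Lemma 2, parts (1) and (2). -/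

open Cardinal

universe u

/-- A C*-algebra `A` is `R_{<k}D` if its representations on complex Hilbert spaces of
Hilbert dimension (cardinality of an orthonormal basis) strictly less than `k` separate
the points of `A`. -/
def IsRltkD (k : Cardinal.{u}) (A : Type u) [NonUnitalCStarAlgebra A] : Prop :=
  ∀ a : A, a ≠ 0 →
    ∃ (H : Type u) (_ : NormedAddCommGroup H) (_ : InnerProductSpace ℂ H)
      (_ : CompleteSpace H) (ι : Type u) (_ : HilbertBasis ι ℂ H)
      (π : A →⋆ₙₐ[ℂ] (H →L[ℂ] H)), #ι < k ∧ π a ≠ 0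

/-- A C*-algebra is `m`-generated if it is generated, as a C*-algebra (i.e. topologically),
by a set of cardinality at most `m`. -/
def MGenerated (m : Cardinal.{u}) (A : Type u) [NonUnitalCStarAlgebra A] : Prop :=
  ∃ G : Set A, #G ≤ m ∧ (NonUnitalStarAlgebra.adjoin ℂ G).topologicalClosure = ⊤

/-- A (unital) representation of the unitization `A⁺` on a complex Hilbert space. -/
structure HilbertRep (A : Type u) [NonUnitalCStarAlgebra A] : Type (u + 1) where
  carrier : Type u
  [nacg : NormedAddCommGroup carrier]
  [ips : InnerProductSpace ℂ carrier]
  [complete : CompleteSpace carrier]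
  hom : Unitization ℂ A →⋆ₐ[ℂ] (carrier →L[ℂ] carrier)

attribute [instance] HilbertRep.nacg HilbertRep.ips HilbertRep.complete

/-- The Hilbert dimension of the representation space is strictly less than `k`. -/
def HilbertRep.dimLt {A : Type u} [NonUnitalCStarAlgebra A] (r : HilbertRep A)
    (k : Cardinal.{u}) : Prop :=
  ∃ (ι : Type u) (_ : HilbertBasis ι ℂ r.carrier), #ι < k

/-- Unitary equivalence of two representations. -/
def HilbertRep.UEquiv {A : Type u} [NonUnitalCStarAlgebra A] (r s : HilbertRep A) : Prop :=
  ∃ V : r.carrier ≃ₗᵢ[ℂ] s.carrier, ∀ (a : Unitization ℂ A) (x : r.carrier),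
    V (r.hom a x) = s.hom a (V x)

/-- The Hilbert dimension of the representation space equals `s`. -/
def HilbertRep.dimEq {A : Type u} [NonUnitalCStarAlgebra A] (r : HilbertRep A)
    (s : Cardinal.{u}) : Prop :=
  ∃ (ι : Type u) (_ : HilbertBasis ι ℂ r.carrier), #ι = s

theorem Subsemigroup.cardinalMk_closure_le {M : Type u} [Semigroup M] (S : Set M) :
    #(Subsemigroup.closure S) ≤ max ℵ₀ #S := by
  have hsub : Subsemigroup.closure S ≤ (FreeSemigroup.lift ((↑) : S → M)).srange :=
    Subsemigroup.closure_le.2 fun x hx ↦ ⟨FreeSemigroup.of ⟨x, hx⟩, by simp⟩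
  have hinj : Function.Injective fun w : FreeSemigroup S ↦ (w.head, w.tail) := by
    rintro ⟨a, l⟩ ⟨b, t⟩ h
    simp_all
  calc #(Subsemigroup.closure S)
      ≤ #(Set.range (FreeSemigroup.lift ((↑) : S → M))) := mk_le_mk_of_subset hsub
    _ ≤ #(FreeSemigroup S) := mk_range_le
    _ ≤ #(S × List S) := mk_le_of_injective hinj
    _ = #S * #(List S) := by simp
    _ ≤ max ℵ₀ #S * max ℵ₀ #S := mul_le_mul' (le_max_right _ _) (mk_list_le_max _)
    _ = max ℵ₀ #S := mul_eq_self (le_max_left _ _)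

theorem exists_span_subset_closure {E : Type u} [NormedAddCommGroup E] [NormedSpace ℂ E]
    (W : Set E) :
    ∃ D : Set E, #D ≤ max ℵ₀ #W ∧ (Submodule.span ℂ W : Set E) ⊆ closure D := by
  classical
  have hsep (l : List W) : TopologicalSpace.IsSeparable
      (Submodule.span ℂ {x : E | ∃ w ∈ l, (w : E) = x} : Set E) := by
    refine Set.Countable.isSeparable ?_ |>.span
    exact (l.toFinset.finite_toSet.image ((↑) : W → E)).subset
      (by rintro x ⟨w, hw, rfl⟩; exact ⟨w, by simpa using hw, rfl⟩) |>.countable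
  choose c hc hcl using hsep
  refine ⟨⋃ l, c l, ?_, fun x hx ↦ ?_⟩
  · calc #(⋃ l, c l) ≤ #(List W) * ⨆ l, #(c l) := mk_iUnion_le _
      _ ≤ max ℵ₀ #W * max ℵ₀ #W := by
        refine mul_le_mul' (mk_list_le_max _) (ciSup_le' fun l ↦ ?_)
        exact ((hc l).le_aleph0).trans (le_max_left _ _)
      _ = max ℵ₀ #W := mul_eq_self (le_max_left _ _)
  · obtain ⟨T, hTW, hxT⟩ := Submodule.mem_span_finite_of_mem_span hx
    let l : List W := T.attach.toList.map fun t ↦ ⟨t.1, hTW t.2⟩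
    have hTl : (T : Set E) ⊆ {x : E | ∃ w ∈ l, (w : E) = x} := fun t ht ↦
      ⟨⟨t, hTW ht⟩, by simp only [l, List.mem_map]; exact ⟨⟨t, ht⟩, by simp, rfl⟩, rfl⟩
    exact closure_mono (Set.subset_iUnion c l) (hcl l (Submodule.span_mono hTl hxT))

theorem MGenerated.exists_dense {m : Cardinal.{u}} {A : Type u} [NonUnitalCStarAlgebra A]
    (hm : ℵ₀ ≤ m) (h : MGenerated m A) : ∃ D : Set A, #D ≤ m ∧ Dense D := by
  obtain ⟨G, hG, htop⟩ := h
  obtain ⟨D, hD, hsub⟩ := exists_span_subset_closure (E := A) (Subsemigroup.closure (G ∪ star G))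
  have hstar : #(star G : Set A) ≤ m := by
    rw [← Set.image_star]
    exact mk_image_le.trans hG
  refine ⟨D, hD.trans (max_le hm ?_), fun a ↦ ?_⟩
  · refine (Subsemigroup.cardinalMk_closure_le _).trans (max_le hm ?_)
    exact (mk_union_le _ _).trans ((add_le_add hG hstar).trans (add_eq_self hm).le)
  · have ha : a ∈ (NonUnitalStarAlgebra.adjoin ℂ G).topologicalClosure := by simp [htop]
    rw [← NonUnitalStarAlgebra.adjoin_eq_span] at hsub
    exact closure_minimal hsub isClosed_closure ha

/-- The unital extension of a representation to the unitization. -/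
noncomputable def HilbertRep.ofNonUnital {A : Type u} [NonUnitalCStarAlgebra A] {H : Type u}
    [NormedAddCommGroup H] [InnerProductSpace ℂ H] [CompleteSpace H]
    (π : A →⋆ₙₐ[ℂ] (H →L[ℂ] H)) : HilbertRep A where
  carrier := H
  hom := Unitization.starLift π

/-- The representation of the unitization on `ℓ²(ι)` by scalars. -/
noncomputable def HilbertRep.scalar (A : Type u) [NonUnitalCStarAlgebra A] (ι : Type u) :
    HilbertRep A :=
  HilbertRep.ofNonUnital (0 : A →⋆ₙₐ[ℂ] (lp (fun _ : ι ↦ ℂ) 2 →L[ℂ] lp (fun _ : ι ↦ ℂ) 2))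

theorem HilbertRep.dimEq_scalar (A : Type u) [NonUnitalCStarAlgebra A] (ι : Type u) :
    (HilbertRep.scalar A ι).dimEq #ι :=
  ⟨ι, HilbertBasis.ofRepr (LinearIsometryEquiv.refl ℂ (lp (fun _ : ι ↦ ℂ) 2)), rfl⟩

theorem HilbertRep.exists_ne_zero_scalar (A : Type u) [NonUnitalCStarAlgebra A] (ι : Type u)
    [Nonempty ι] : ∃ x : (HilbertRep.scalar A ι).carrier, x ≠ 0 := by
  classical
  obtain ⟨i⟩ := ‹Nonempty ι›
  refine ⟨(lp.single 2 i (1 : ℂ) : lp (fun _ : ι ↦ ℂ) 2), fun h ↦ ?_⟩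
  have h0 : (lp.single 2 i (1 : ℂ) : lp (fun _ : ι ↦ ℂ) 2) i = 0 :=
    congrArg (fun f : lp (fun _ : ι ↦ ℂ) 2 ↦ f i) h
  simp at h0

theorem HilbertRep.scalar_hom_ne_zero (A : Type u) [NonUnitalCStarAlgebra A] (ι : Type u)
    [Nonempty ι] {a : Unitization ℂ A} (ha : a.fst ≠ 0) : (HilbertRep.scalar A ι).hom a ≠ 0 := by
  obtain ⟨x, hx⟩ := HilbertRep.exists_ne_zero_scalar A ι
  intro h
  have hax : (HilbertRep.scalar A ι).hom a x = a.fst • x := by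
    change (algebraMap ℂ ((HilbertRep.scalar A ι).carrier →L[ℂ] (HilbertRep.scalar A ι).carrier)
      a.fst + 0) x = _
    rw [add_zero, Algebra.algebraMap_eq_smul_one]
    rfl
  rw [h] at hax
  exact smul_ne_zero ha hx hax.symm

theorem HilbertRep.UEquiv.refl {A : Type u} [NonUnitalCStarAlgebra A] (r : HilbertRep A) :
    r.UEquiv r :=
  ⟨LinearIsometryEquiv.refl ℂ r.carrier, fun _ _ ↦ rfl⟩

/-- A separating family of representations can be cut down to one indexed by pairs of an
element of a dense set and a natural number. -/
theorem IsRltkD.exists_small_family {k m : Cardinal.{u}} (hm : ℵ₀ ≤ m) {A : Type u}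
    [NonUnitalCStarAlgebra A] (hgen : MGenerated m A) (hRkD : IsRltkD k A) :
    ∃ (I : Type u) (r : I → HilbertRep A), #I ≤ m ∧ (∀ i, (r i).dimLt k) ∧
      (∀ i, ∃ x : (r i).carrier, x ≠ 0) ∧
      ∀ a : A, a ≠ 0 → ∃ i, (r i).hom (a : Unitization ℂ A) ≠ 0 := by
  obtain ⟨D, hD, hdense⟩ := hgen.exists_dense hm
  let good (p : D × ℕ) (r : HilbertRep A) : Prop :=
    r.dimLt k ∧ (∃ x : r.carrier, x ≠ 0) ∧
      ∀ b ∈ Metric.ball (p.1 : A) (1 / (p.2 + 1)), r.hom (b : Unitization ℂ A) ≠ 0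
  refine ⟨{p : D × ℕ // ∃ r, good p r}, fun p ↦ p.2.choose, ?_, fun p ↦ p.2.choose_spec.1,
    fun p ↦ p.2.choose_spec.2.1, fun a ha ↦ ?_⟩
  · refine (mk_subtype_le _).trans ?_
    simpa using (mul_le_mul' hD hm).trans (mul_eq_self hm).le
  · obtain ⟨H, _, _, _, ι, e, π, hι, hπ⟩ := hRkD a ha
    have hcont : Continuous π := by
      open scoped CStarAlgebra in exact map_continuous π
    obtain ⟨ε, hε, hball⟩ := Metric.isOpen_iff.1 (isOpen_ne.preimage hcont) a hπ
    obtain ⟨n, hn⟩ := exists_nat_one_div_lt (half_pos hε)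
    obtain ⟨d, hdD, hd⟩ := hdense.exists_dist_lt a (Nat.one_div_pos_of_nat (α := ℝ) (n := n))
    have hgood : ∃ r, good (⟨d, hdD⟩, n) r := by
      refine ⟨HilbertRep.ofNonUnital π, ⟨ι, e, hι⟩, ?_, fun b hb ↦ ?_⟩
      · by_contra! h
        exact hπ (ContinuousLinearMap.ext fun x ↦ h _)
      · have hb' : b ∈ Metric.ball a ε := by
          have := dist_triangle_right b a d
          rw [Metric.mem_ball] at hb ⊢
          linarith
        have : π b ≠ 0 := hball hb'
        change Unitization.starLift π b ≠ 0
        simpa [Unitization.starLift] using this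
    exact ⟨⟨_, hgood⟩, hgood.choose_spec.2.2 a hd⟩

theorem Cardinal.exists_mk_Iio_toType_eq {k s : Cardinal.{u}} (h : s < k) :
    ∃ x : k.ord.ToType, #(Set.Iio x) = s := by
  have hs : s.ord < Ordinal.type (α := k.ord.ToType) (· < ·) := by
    simpa using ord_lt_ord.2 h
  obtain ⟨x, hx⟩ := Ordinal.typein_surj (α := k.ord.ToType) (· < ·) hs
  refine ⟨x, ?_⟩
  have := Ordinal.card_typein (r := ((· < ·) : k.ord.ToType → _ → Prop)) x
  rw [hx, card_ord] at this
  exact this.symm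

theorem stmt_4 (k m : Cardinal.{u}) (hk : ℵ₀ ≤ k) (hkm : k ≤ m)
    (A : Type u) [NonUnitalCStarAlgebra A]
    (hgen : MGenerated m A) (hRkD : IsRltkD k A) :
    ∃ (Λ : Type u) (r : Λ → HilbertRep A),
      #Λ = m ∧
      (∀ l : Λ, ∃ x : (r l).carrier, x ≠ 0) ∧
      (∀ l : Λ, (r l).dimLt k) ∧
      (∀ a : Unitization ℂ A, a ≠ 0 → ∃ l : Λ, (r l).hom a ≠ 0) ∧
      (∀ l₀ : Λ, #{l : Λ // (r l).UEquiv (r l₀)} = m) ∧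
      (∀ s : Cardinal.{u}, s ≠ 0 → s < k → ∃ l : Λ, (r l).dimEq s) := by
  have hm : ℵ₀ ≤ m := hk.trans hkm
  obtain ⟨I, ρ, hI, hdim, hne, hsep⟩ := hRkD.exists_small_family hm hgen
  let J : Type u := {x : k.ord.ToType // Nonempty (Set.Iio x)}
  have hJ : #J ≤ m := (mk_subtype_le _).trans (by simpa using hkm)
  have hJs (s : Cardinal.{u}) (hs : s ≠ 0) (hsk : s < k) : ∃ j : J, #(Set.Iio j.1) = s := by
    obtain ⟨x, hx⟩ := exists_mk_Iio_toType_eq hsk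
    exact ⟨⟨x, mk_ne_zero_iff.1 (hx ▸ hs)⟩, hx⟩
  let σ : J ⊕ I → HilbertRep A := Sum.elim (fun j ↦ HilbertRep.scalar A (Set.Iio j.1)) ρ
  obtain ⟨j₁, -⟩ := hJs 1 one_ne_zero (one_lt_aleph0.trans_le hk)
  have hΛ : #((J ⊕ I) × m.out) = m := by
    have hsum : #(J ⊕ I) ≤ m := by
      simpa using (add_le_add hJ hI).trans (add_eq_self hm).le
    have : Nonempty (J ⊕ I) := ⟨Sum.inl j₁⟩
    rw [mk_prod, lift_id, lift_id, mk_out]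
    exact mul_eq_right hm hsum (mk_ne_zero _)
  have : Nonempty m.out := mk_ne_zero_iff.1 (by simpa using (aleph0_pos.trans_le hm).ne')
  let t : m.out := Classical.arbitrary _
  refine ⟨(J ⊕ I) × m.out, fun l ↦ σ l.1, hΛ, ?_, ?_, fun a ha ↦ ?_, fun l₀ ↦ ?_,
    fun s hs hsk ↦ ?_⟩
  · rintro ⟨j | i, _⟩
    · have := j.2
      exact HilbertRep.exists_ne_zero_scalar A _
    · exact hne i
  · rintro ⟨j | i, _⟩
    · obtain ⟨ι, e, hι⟩ := HilbertRep.dimEq_scalar A (Set.Iio j.1)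
      exact ⟨ι, e, hι ▸ (mk_Iio_lt j.1 (by simp)).trans_eq (mk_ord_toType k)⟩
    · exact hdim i
  · by_cases hfst : a.fst = 0
    · obtain ⟨b, rfl⟩ : ∃ b : A, (b : Unitization ℂ A) = a :=
        ⟨a.snd, Unitization.ext (by simp [hfst]) (by simp)⟩
      obtain ⟨i, hi⟩ := hsep b (by rintro rfl; simp at ha)
      exact ⟨(Sum.inr i, t), hi⟩
    · have := j₁.2
      exact ⟨(Sum.inl j₁, t), HilbertRep.scalar_hom_ne_zero A _ hfst⟩
  · refine le_antisymm ((mk_subtype_le _).trans hΛ.le) ?_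
    conv_lhs => rw [← mk_out m]
    refine mk_le_of_injective
      (f := fun u ↦ ⟨(l₀.1, u), HilbertRep.UEquiv.refl (σ l₀.1)⟩) fun u v h ↦ ?_
    simpa using h
  · obtain ⟨j, hj⟩ := hJs s hs hsk
    exact ⟨(Sum.inl j, t), hj ▸ HilbertRep.dimEq_scalar A (Set.Iio j.1)⟩
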